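/- For u ∈ ℕ let f ∈ C^u(ℝ²) and set f_j := f·φ_j, where φ ∈ C₀^∞([−π,π]²) and φ_j(x) := φ(2^{j/2}x). Let Ψ^{(i)} ∈ W₂^q with q ≥ 2, i ∈ {h,v}. Then for any multi-index r ∈ ℕ₀² with |r|₁ ≤ q there is a constant C(u, q) > 0 such that ‖∂^r[𝓕[f_j]·Ψ_{j,ℓ}^{(i)}]‖²_{L₂(ℝ²)} ≤ C(u, q) · 2^{−j(2u + 1 + |r|₁)}. -/

import Mathlib

open Real MeasureTheory Set
open scoped Classical

noncomputable section

/-- A window function `g ∈ 𝒲`: nonnegative, even, with support `(-2/3, 2/3)`,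
and whose integer translates form a partition of unity. -/
structure IsWindow (g : ℝ → ℝ) : Prop where
  nonneg : ∀ x, 0 ≤ g x
  even_fun : ∀ x, g (-x) = g x
  supp_eq : Function.support g = Ioo (-(2/3) : ℝ) (2/3)
  partition : ∀ x : ℝ, HasSum (fun z : ℤ => g (x + (z : ℝ))) 1

/-- `g ∈ 𝒲^q`: a window function that is `q`-times continuously differentiable. -/
def IsWindowQ (g : ℝ → ℝ) (q : ℕ) : Prop := IsWindow g ∧ ContDiff ℝ q g

/-- `g̃(x) = g(x/2) - g(x)`. -/
def gtilde (g : ℝ → ℝ) : ℝ → ℝ := fun x => g (x / 2) - g x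

/-- Horizontal bivariate window `Ψ^{(h)}(x) = g̃(x₁) g(x₂)`. -/
def PsiH (g : ℝ → ℝ) : ℝ × ℝ → ℝ := fun x => gtilde g x.1 * g x.2

/-- Vertical bivariate window `Ψ^{(v)}(x) = g(x₁) g̃(x₂)`. -/
def PsiV (g : ℝ → ℝ) : ℝ × ℝ → ℝ := fun x => g x.1 * gtilde g x.2

/-- `Ψ_{j,ℓ}^{(i)}(ξ) = Ψ^{(i)}((N_{j,ℓ}^{(i)})^{-T} ξ)`, where the inverse transpose of the
shear matrices has been written out explicitly.  `i = true` is the horizontal case `(h)`,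
`i = false` the vertical case `(v)`. -/
def PsiJL (g : ℝ → ℝ) (i : Bool) (j : ℕ) (ℓ : ℤ) : ℝ × ℝ → ℝ := fun ξ =>
  if i then
    PsiH g ((2:ℝ) ^ (-(j:ℝ)) * ξ.1,
            (2:ℝ) ^ (-(j:ℝ)/2) * ξ.2 - (ℓ:ℝ) * (2:ℝ) ^ (-(j:ℝ)) * ξ.1)
  else
    PsiV g ((2:ℝ) ^ (-(j:ℝ)/2) * ξ.1 - (ℓ:ℝ) * (2:ℝ) ^ (-(j:ℝ)) * ξ.2,
            (2:ℝ) ^ (-(j:ℝ)) * ξ.2)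

/-- Discrete angles `θ_{j,ℓ}^{(h)} = arctan(ℓ 2^{-j/2})`,
`θ_{j,ℓ}^{(v)} = arccot(ℓ 2^{-j/2}) = π/2 - arctan(ℓ 2^{-j/2})`. -/
def thetaJL (i : Bool) (j : ℕ) (ℓ : ℤ) : ℝ :=
  if i then arctan ((ℓ:ℝ) * (2:ℝ) ^ (-(j:ℝ)/2))
  else π/2 - arctan ((ℓ:ℝ) * (2:ℝ) ^ (-(j:ℝ)/2))

/-- The pattern `𝒫(N_{j,ℓ}^{(i)}) = (N_{j,ℓ}^{(i)})^{-1} ℤ² ∩ [-1/2,1/2)²`: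
`y` belongs to the pattern iff `N_{j,ℓ}^{(i)} y ∈ ℤ²` and `y ∈ [-1/2,1/2)²`. -/
def pattern (i : Bool) (j : ℕ) (ℓ : ℤ) : Set (ℝ × ℝ) :=
  {y : ℝ × ℝ |
    (∃ k : ℤ × ℤ,
      (if i then ((2:ℝ)^(j:ℝ) * y.1 + (ℓ:ℝ) * (2:ℝ)^((j:ℝ)/2) * y.2, (2:ℝ)^((j:ℝ)/2) * y.2)
       else ((2:ℝ)^((j:ℝ)/2) * y.1, (ℓ:ℝ) * (2:ℝ)^((j:ℝ)/2) * y.1 + (2:ℝ)^(j:ℝ) * y.2))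
        = ((k.1 : ℝ), (k.2 : ℝ)))
    ∧ y.1 ∈ Ico (-(1/2) : ℝ) (1/2) ∧ y.2 ∈ Ico (-(1/2) : ℝ) (1/2)}

/-- `ỹ = y - (2^{-j-1},0)ᵀ` in the horizontal case, `ỹ = y - (0,2^{-j-1})ᵀ` in the vertical one. -/
def ytilde (i : Bool) (j : ℕ) (y : ℝ × ℝ) : ℝ × ℝ :=
  if i then (y.1 - (2:ℝ) ^ (-(j:ℝ) - 1), y.2) else (y.1, y.2 - (2:ℝ) ^ (-(j:ℝ) - 1))

/-- The trigonometric polynomial shearlet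
`ψ_{j,ℓ,y}^{(i)}(x) = ∑_{k∈ℤ²} Ψ_{j,ℓ}^{(i)}(k) e^{i k·(x - 2πỹ)}`. -/
def shearlet (g : ℝ → ℝ) (i : Bool) (j : ℕ) (ℓ : ℤ) (y : ℝ × ℝ) : ℝ × ℝ → ℂ := fun x =>
  ∑' k : ℤ × ℤ, (PsiJL g i j ℓ ((k.1 : ℝ), (k.2 : ℝ)) : ℂ) *
    Complex.exp (Complex.I *
      (((k.1 : ℝ) * (x.1 - 2*π*(ytilde i j y).1)
        + (k.2 : ℝ) * (x.2 - 2*π*(ytilde i j y).2) : ℝ) : ℂ))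

/-- `⟨f,h⟩₂ = (2π)^{-2} ∫_{𝕋²} f(x) conj(h(x)) dx`, with the torus realised as `[-π,π]²`. -/
def inner2 (f h : ℝ × ℝ → ℂ) : ℂ :=
  ((2*π)^2 : ℂ)⁻¹ * ∫ x in (Icc (-π) π ×ˢ Icc (-π) π : Set (ℝ × ℝ)), f x * (starRingEnd ℂ) (h x)

/-- The `2π`-periodization `f^{2π} = ∑_{n∈ℤ²} f(· + 2πn)`. -/
def periodize (f : ℝ × ℝ → ℝ) : ℝ × ℝ → ℝ := fun x =>
  ∑' n : ℤ × ℤ, f (x.1 + 2*π*(n.1 : ℝ), x.2 + 2*π*(n.2 : ℝ))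

/-- Euclidean norm `|x|₂` on `ℝ²`. -/
def nrm2 (x : ℝ × ℝ) : ℝ := Real.sqrt (x.1^2 + x.2^2)

/-- First partial derivative of a complex-valued function of two real variables. -/
def pd1 (f : ℝ × ℝ → ℂ) : ℝ × ℝ → ℂ := fun x => deriv (fun t => f (t, x.2)) x.1

/-- Second partial derivative of a complex-valued function of two real variables. -/
def pd2 (f : ℝ × ℝ → ℂ) : ℝ × ℝ → ℂ := fun x => deriv (fun t => f (x.1, t)) x.2

/-- `∂^r = ∂^{r₁+r₂}/∂x₁^{r₁}∂x₂^{r₂}` (complex-valued). -/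
def pd (r : ℕ × ℕ) (f : ℝ × ℝ → ℂ) : ℝ × ℝ → ℂ := pd1^[r.1] (pd2^[r.2] f)

/-- First partial derivative of a real-valued function of two real variables. -/
def pdR1 (f : ℝ × ℝ → ℝ) : ℝ × ℝ → ℝ := fun x => deriv (fun t => f (t, x.2)) x.1

/-- Second partial derivative of a real-valued function of two real variables. -/
def pdR2 (f : ℝ × ℝ → ℝ) : ℝ × ℝ → ℝ := fun x => deriv (fun t => f (x.1, t)) x.2

/-- `∂^r = ∂^{r₁+r₂}/∂x₁^{r₁}∂x₂^{r₂}` (real-valued). -/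
def pdR (r : ℕ × ℕ) (f : ℝ × ℝ → ℝ) : ℝ × ℝ → ℝ := pdR1^[r.1] (pdR2^[r.2] f)

/-- The Fourier transform `𝓕f(x) = (2π)^{-2} ∫_{ℝ²} f(ξ) e^{-iξ·x} dξ`. -/
def FT (f : ℝ × ℝ → ℂ) : ℝ × ℝ → ℂ := fun x =>
  ((2*π)^2 : ℂ)⁻¹ * ∫ ξ : ℝ × ℝ, f ξ * Complex.exp (-(Complex.I) * ((ξ.1*x.1 + ξ.2*x.2 : ℝ) : ℂ))

/-- Rotation matrix `R_γ` acting on `ℝ²`. -/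
def rotM (γ : ℝ) (x : ℝ × ℝ) : ℝ × ℝ :=
  (Real.cos γ * x.1 - Real.sin γ * x.2, Real.sin γ * x.1 + Real.cos γ * x.2)

/-- Transposed rotation matrix `R_γᵀ` acting on `ℝ²`. -/
def rotT (γ : ℝ) (x : ℝ × ℝ) : ℝ × ℝ :=
  (Real.cos γ * x.1 + Real.sin γ * x.2, -(Real.sin γ) * x.1 + Real.cos γ * x.2)

/-- The standard edge fragment `ℰ_j(x) = f(x) φ(2^{j/2}x) χ_{{x₁ ≥ E(x₂)}}(x)`. -/
def edgeFragment (f φ : ℝ × ℝ → ℝ) (E : ℝ → ℝ) (j : ℕ) : ℝ × ℝ → ℝ := fun x =>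
  f x * φ ((2:ℝ)^((j:ℝ)/2) * x.1, (2:ℝ)^((j:ℝ)/2) * x.2) * (if E x.2 ≤ x.1 then 1 else 0)

/-- The second-order differential operator `L = I + 2^j Δ`. -/
def Lop (j : ℕ) (f : ℝ × ℝ → ℂ) : ℝ × ℝ → ℂ := fun x =>
  f x + (Complex.ofReal ((2:ℝ)^(j:ℝ))) * (pd (2,0) f x + pd (0,2) f x)

/-- The dyadic square `Q` indexed by `(n₁,n₂)` at scale `j`. -/
def dyadicSquare (j : ℕ) (n : ℕ × ℕ) : Set (ℝ × ℝ) :=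
  Ico (2*π*(n.1:ℝ)*(2:ℝ)^(-(j:ℝ)/2) - π) (2*π*((n.1:ℝ)+1)*(2:ℝ)^(-(j:ℝ)/2) - π) ×ˢ
  Ico (2*π*(n.2:ℝ)*(2:ℝ)^(-(j:ℝ)/2) - π) (2*π*((n.2:ℝ)+1)*(2:ℝ)^(-(j:ℝ)/2) - π)

/-- The indices of the dyadic squares at scale `j` meeting `∂T` (the set `𝒬_j^1`). -/
def Q1set (T : Set (ℝ × ℝ)) (j : ℕ) : Finset (ℕ × ℕ) :=
  (Finset.range (2^(j/2)) ×ˢ Finset.range (2^(j/2))).filter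
    (fun n => (frontier T ∩ dyadicSquare j n).Nonempty)

/-- Fresnel integral `Fc(x) = ∫₀ˣ cos v/√v dv`. -/
def Fc (x : ℝ) : ℝ := ∫ v in (0:ℝ)..x, Real.cos v / Real.sqrt v

/-- Fresnel integral `Fs(x) = ∫₀ˣ sin v/√v dv`. -/
def Fs (x : ℝ) : ℝ := ∫ v in (0:ℝ)..x, Real.sin v / Real.sqrt v

/-- `F⁺ = Fc + Fs`. -/
def Fp (x : ℝ) : ℝ := Fc x + Fs x

/-- `F⁻ = Fc - Fs`. -/
def Fm (x : ℝ) : ℝ := Fc x - Fs x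

/-- `a(λ,p,A)` of the paper. -/
def aInt (g : ℝ → ℝ) (l p A : ℝ) : ℝ :=
  ∫ v in Ioi (0:ℝ),
    (g (2*Real.sqrt (A*l*v) + p*l) + g (2*Real.sqrt (A*l*v) - p*l)) * (Real.cos v / Real.sqrt v)

/-- `b(λ,p,A)` of the paper. -/
def bInt (g : ℝ → ℝ) (l p A : ℝ) : ℝ :=
  ∫ v in Ioi (0:ℝ),
    (g (2*Real.sqrt (A*l*v) + p*l) + g (2*Real.sqrt (A*l*v) - p*l)) * (Real.sin v / Real.sqrt v)

/-- `P₁(D,p,A)` of the paper. -/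
def P1 (g : ℝ → ℝ) (D p A : ℝ) : ℝ :=
  ∫ l in (1/3 : ℝ)..(4/3),
    gtilde g l * l⁻¹ *
      ((aInt g l p A + bInt g l p A) * Real.cos (D*l)
        + (aInt g l p A - bInt g l p A) * Real.sin (D*l))

/-- `P₂(D,p,A)` of the paper. -/
def P2 (g : ℝ → ℝ) (D p A : ℝ) : ℝ :=
  ∫ l in (1/3 : ℝ)..(4/3),
    gtilde g l * l⁻¹ *
      ((aInt g l p A + bInt g l p A) * Real.sin (D*l)
        - (aInt g l p A - bInt g l p A) * Real.cos (D*l))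

open scoped FourierTransform SchwartzMap ContDiff

/-- Plancherel's identity for the Fourier integral on `L¹ ∩ L²`. -/
theorem memLp_fourier_and_integral_norm_sq {E : Type*} [NormedAddCommGroup E]
    [InnerProductSpace ℝ E] [FiniteDimensional ℝ E] [MeasurableSpace E] [BorelSpace E] {h : E → ℂ}
    (h1 : Integrable h) (h2 : MemLp h 2) :
    MemLp (𝓕 h) 2 ∧ ∫ x, ‖𝓕 h x‖ ^ 2 = ∫ x, ‖h x‖ ^ 2 := by
  have hcont : Continuous (𝓕 h) :=
    VectorFourier.fourierIntegral_continuous Real.continuous_fourierChar continuous_inner h1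
  set H : Lp ℂ 2 (volume : Measure E) := h2.toLp h
  have hae : ∀ᵐ x, 𝓕 h x = (𝓕 H : Lp ℂ 2 (volume : Measure E)) x := by
    refine ae_eq_of_integral_contDiff_smul_eq hcont.locallyIntegrable
      ((Lp.memLp _).locallyIntegrable (by norm_num)) ?_
    intro g hg hgc
    have hg₁ : HasCompactSupport (Complex.ofRealCLM ∘ g) := hgc.comp_left rfl
    have hg₂ : ContDiff ℝ ∞ (Complex.ofRealCLM ∘ g) := by fun_prop
    set G := hg₁.toSchwartzMap hg₂
    have e1 : ∫ x, G x • (𝓕 H : Lp ℂ 2 (volume : Measure E)) x = ∫ x, (𝓕 G) x • H x := by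
      rw [← Lp.toTemperedDistribution_apply, ← Lp.fourier_toTemperedDistribution_eq,
        TemperedDistribution.fourier_apply, Lp.toTemperedDistribution_apply]
    have e2 : ∫ x, (𝓕 G) x • H x = ∫ x, (𝓕 G) x • h x := by
      apply integral_congr_ae
      filter_upwards [h2.coeFn_toLp] with x hx
      simp [H, hx]
    have e3 : ∫ x, (𝓕 G) x • h x = ∫ x, G x • 𝓕 h x := by
      have := VectorFourier.integral_bilin_fourierIntegral_eq_flip (ContinuousLinearMap.lsmul ℂ ℂ)
        (L := innerₗ E) (μ := volume) (ν := volume)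
        Real.continuous_fourierChar continuous_inner G.integrable h1
      simpa using! this
    have := (e1.trans (e2.trans e3)).symm
    simpa [G] using! this
  refine ⟨(memLp_congr_ae hae).2 (Lp.memLp _), ?_⟩
  have n1 : ‖(𝓕 H : Lp ℂ 2 (volume : Measure E))‖ ^ 2 = ‖H‖ ^ 2 := by rw [Lp.norm_fourier_eq]
  have key : ∀ F : Lp ℂ 2 (volume : Measure E), ‖F‖ ^ 2 = ∫ x, ‖F x‖ ^ 2 := by
    intro F
    have h3 := @inner_self_eq_norm_sq ℂ _ _ _ _ F
    rw [← h3, L2.inner_def]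
    simp_rw [inner_self_eq_norm_sq_to_K]
    norm_cast
  rw [key, key] at n1
  refine ((integral_congr_ae (hae.mono fun x hx => ?_)).trans n1).trans
    (integral_congr_ae ((h2.coeFn_toLp).mono fun x hx => ?_))
  · simp [hx]
  · simp [H, hx]

theorem FT_eq_fourier (h : ℝ × ℝ → ℂ) (x : ℝ × ℝ) :
    FT h x = ((2 * (π : ℂ)) ^ 2)⁻¹ *
      𝓕 (fun v : WithLp 2 (ℝ × ℝ) => h v.ofLp) (WithLp.toLp 2 ((2 * π)⁻¹ • x)) := by
  unfold FT
  congr 1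
  rw [Real.fourier_eq', ← (WithLp.volume_preserving_ofLp ℝ ℝ).integral_comp
    (MeasurableEquiv.toLp 2 (ℝ × ℝ)).symm.measurableEmbedding]
  congr 1 with v
  rw [smul_eq_mul, mul_comm]
  congr 2
  simp only [WithLp.prod_inner_apply]
  push_cast
  simp
  field_simp

/-- Plancherel for `FT` on continuous compactly supported functions. -/
theorem memLp_FT_and_integral_norm_sq {h : ℝ × ℝ → ℂ} (hc : Continuous h)
    (hs : HasCompactSupport h) :
    MemLp (FT h) 2 ∧ ∫ x, ‖FT h x‖ ^ 2 = ((2 * π) ^ 2)⁻¹ * ∫ x, ‖h x‖ ^ 2 := by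
  have mp := WithLp.volume_preserving_ofLp ℝ ℝ
  have mp' : MeasurePreserving (MeasurableEquiv.toLp 2 (ℝ × ℝ)) :=
    mp.symm (MeasurableEquiv.toLp 2 (ℝ × ℝ)).symm
  have i1 : Integrable (fun v : WithLp 2 (ℝ × ℝ) => h v.ofLp) :=
    mp.integrable_comp_of_integrable (hc.integrable_of_hasCompactSupport hs)
  have i2 : MemLp (fun v : WithLp 2 (ℝ × ℝ) => h v.ofLp) 2 :=
    (hc.memLp_of_hasCompactSupport hs).comp_measurePreserving mp
  obtain ⟨m, e⟩ := memLp_fourier_and_integral_norm_sq i1 i2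
  have m' := m.comp_measurePreserving mp'
  have e' := mp'.integral_comp (MeasurableEquiv.toLp 2 (ℝ × ℝ)).measurableEmbedding
    (fun w => ‖𝓕 (fun v : WithLp 2 (ℝ × ℝ) => h v.ofLp) w‖ ^ 2)
  have e'' := mp.integral_comp (MeasurableEquiv.toLp 2 (ℝ × ℝ)).symm.measurableEmbedding
    (fun w => ‖h w‖ ^ 2)
  have hpi : (0 : ℝ) < 2 * π := by positivity
  have hnorm : ∀ x, ‖FT h x‖ ^ 2 = (((2 * π) ^ 2)⁻¹) ^ 2 *
      ‖𝓕 (fun v : WithLp 2 (ℝ × ℝ) => h v.ofLp) (WithLp.toLp 2 ((2 * π)⁻¹ • x))‖ ^ 2 := by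
    intro x
    have : ‖((2 * (π : ℂ)) ^ 2)⁻¹‖ = ((2 * π) ^ 2)⁻¹ := by
      rw [norm_inv, norm_pow]; norm_cast; rw [Real.norm_of_nonneg hpi.le]
    rw [FT_eq_fourier, norm_mul, this, mul_pow]
  have hsq : ∫ x, ‖FT h x‖ ^ 2 = ((2 * π) ^ 2)⁻¹ * ∫ x, ‖h x‖ ^ 2 := by
    rw [← e'', ← e, ← e']
    simp only [hnorm]
    rw [integral_const_mul, Measure.integral_comp_smul volume
      (fun y => ‖𝓕 (fun v : WithLp 2 (ℝ × ℝ) => h v.ofLp) (WithLp.toLp 2 y)‖ ^ 2)]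
    have hdim : Module.finrank ℝ (ℝ × ℝ) = 2 := by simp
    simp only [hdim, smul_eq_mul, MeasurableEquiv.coe_toLp]
    rw [abs_of_pos (by positivity)]
    field_simp
  have hmeas : Continuous (FT h) := by
    rw [funext (FT_eq_fourier h)]
    refine continuous_const.mul ((VectorFourier.fourierIntegral_continuous
      Real.continuous_fourierChar continuous_inner i1).comp ?_)
    exact (WithLp.prod_continuous_toLp 2 ℝ ℝ).comp (continuous_const_smul _)
  refine ⟨(memLp_two_iff_integrable_sq_norm hmeas.aestronglyMeasurable).2 ?_, hsq⟩
  have m2 := (memLp_two_iff_integrable_sq_norm m'.1).1 m'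
  have m3 := (integrable_comp_smul_iff volume _ (inv_ne_zero hpi.ne')).2 m2
  simp only [hnorm]
  exact m3.const_mul _

theorem norm_exp_neg_I_mul (t : ℝ) : ‖Complex.exp (-Complex.I * (t : ℂ))‖ = 1 := by
  rw [neg_mul, ← mul_neg, ← Complex.ofReal_neg, mul_comm, Complex.norm_exp_ofReal_mul_I]

theorem continuous_FT {h : ℝ × ℝ → ℂ} (hi : Integrable h) : Continuous (FT h) := by
  refine continuous_const.mul (continuous_of_dominated (bound := fun ξ => ‖h ξ‖) ?_ ?_ hi.norm ?_)
  · exact fun x => hi.1.mul (by fun_prop : Continuous _).aestronglyMeasurable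
  · exact fun x => .of_forall fun ξ => by rw [norm_mul, norm_exp_neg_I_mul, mul_one]
  · exact .of_forall fun ξ => by fun_prop

theorem FT_comp_swap (h : ℝ × ℝ → ℂ) (x : ℝ × ℝ) : FT (fun ξ => h ξ.swap) x = FT h x.swap := by
  unfold FT
  congr 1
  have mp : MeasurePreserving (Prod.swap : ℝ × ℝ → ℝ × ℝ) := Measure.measurePreserving_swap
  rw [← mp.integral_comp MeasurableEquiv.prodComm.measurableEmbedding]
  congr 1 with ξ
  simp [add_comm]

theorem hasDerivAt_FT_fst {h : ℝ × ℝ → ℂ} (hc : Continuous h) (hs : HasCompactSupport h)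
    (x y : ℝ) :
    HasDerivAt (fun t => FT h (t, y)) (-Complex.I * FT (fun ξ => (ξ.1 : ℂ) * h ξ) (x, y)) x := by
  have hi' : Integrable (fun ξ : ℝ × ℝ => (ξ.1 : ℂ) * h ξ) :=
    (by fun_prop : Continuous fun ξ : ℝ × ℝ => (ξ.1 : ℂ) * h ξ).integrable_of_hasCompactSupport
      hs.mul_left
  have key := hasDerivAt_integral_of_dominated_loc_of_deriv_le (μ := volume) (s := univ) (x₀ := x)
    (F := fun t ξ => h ξ * Complex.exp (-(Complex.I) * ((ξ.1*t + ξ.2*y : ℝ) : ℂ)))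
    (F' := fun t ξ => -Complex.I * (((ξ.1 : ℂ) * h ξ) *
      Complex.exp (-(Complex.I) * ((ξ.1*t + ξ.2*y : ℝ) : ℂ))))
    (bound := fun ξ => ‖(ξ.1 : ℂ) * h ξ‖) Filter.univ_mem
    (.of_forall fun t => (by fun_prop : Continuous _).aestronglyMeasurable)
    ((by fun_prop : Continuous _).integrable_of_hasCompactSupport hs.mul_right)
    (by fun_prop : Continuous _).aestronglyMeasurable
    (.of_forall fun ξ t _ => by
      rw [norm_mul, norm_mul (_ * _), norm_exp_neg_I_mul, norm_neg, Complex.norm_I, one_mul,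
        mul_one])
    hi'.norm
    (.of_forall fun ξ t _ => by
      have h1 : HasDerivAt (fun t : ℝ => (-(Complex.I) * ((ξ.1*t + ξ.2*y : ℝ) : ℂ)))
          (-(Complex.I) * (ξ.1 : ℂ)) t := by
        refine HasDerivAt.const_mul _ (HasDerivAt.ofReal_comp ?_)
        simpa using ((hasDerivAt_id t).const_mul ξ.1).add_const (ξ.2 * y)
      convert! (h1.cexp).const_mul (h ξ) using 1
      ring)
  convert! key.2.const_mul (((2 * (π : ℂ)) ^ 2)⁻¹) using 1
  rw [integral_const_mul]
  unfold FT
  ring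

theorem hasDerivAt_FT_snd {h : ℝ × ℝ → ℂ} (hc : Continuous h) (hs : HasCompactSupport h)
    (x y : ℝ) :
    HasDerivAt (fun t => FT h (x, t)) (-Complex.I * FT (fun ξ => (ξ.2 : ℂ) * h ξ) (x, y)) y := by
  have key := hasDerivAt_FT_fst (h := fun ξ => h ξ.swap) (hc.comp continuous_swap)
    (hs.comp_homeomorph (Homeomorph.prodComm ℝ ℝ)) y x
  have e1 : ∀ t, FT (fun ξ => h ξ.swap) (t, x) = FT h (x, t) := fun t => FT_comp_swap h _
  have e2 := FT_comp_swap (fun ξ => (ξ.2 : ℂ) * h ξ) (y, x)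
  simp only [e1] at key
  simpa only [Prod.snd_swap, Prod.swap_prod_mk] using (e2 ▸ key :)

theorem FT_fderiv_fst {h : ℝ × ℝ → ℂ} (hd : ContDiff ℝ 1 h) (hs : HasCompactSupport h)
    (x : ℝ × ℝ) :
    FT (fun ξ => fderiv ℝ h ξ (1, 0)) x = Complex.I * x.1 * FT h x := by
  set e : ℝ × ℝ → ℂ := fun ξ => Complex.exp (-(Complex.I) * ((ξ.1*x.1 + ξ.2*x.2 : ℝ) : ℂ))
  have hed : Differentiable ℝ e := by
    intro ξ
    refine DifferentiableAt.cexp (DifferentiableAt.const_mul ?_ _)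
    have hlin : Differentiable ℝ fun ξ : ℝ × ℝ => ξ.1 * x.1 + ξ.2 * x.2 := by fun_prop
    exact Complex.ofRealCLM.differentiableAt.comp ξ (hlin ξ)
  have hec : Continuous e := by fun_prop
  have he : ∀ ξ, fderiv ℝ e ξ (1, 0) = -Complex.I * x.1 * e ξ := by
    intro ξ
    have h0 : HasFDerivAt (fun ξ : ℝ × ℝ => ξ.1*x.1 + ξ.2*x.2)
      (x.1 • ContinuousLinearMap.fst ℝ ℝ ℝ + x.2 • ContinuousLinearMap.snd ℝ ℝ ℝ) ξ :=
      (hasFDerivAt_fst.mul_const x.1).add (hasFDerivAt_snd.mul_const x.2)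
    have h1 := ((Complex.ofRealCLM.hasFDerivAt.comp ξ h0).const_mul (-Complex.I)).cexp
    have h2 : fderiv ℝ e ξ = _ := h1.fderiv
    rw [h2]
    simp [e]
    ring
  have hdc : Continuous fun ξ => fderiv ℝ h ξ (1, 0) :=
    (hd.continuous_fderiv (by norm_num)).clm_apply continuous_const
  have hds : HasCompactSupport fun ξ => fderiv ℝ h ξ (1, 0) := hs.fderiv_apply ℝ _
  have key := integral_mul_fderiv_eq_neg_fderiv_mul_of_integrable (μ := volume) (f := h) (g := e)
    (v := ((1, 0) : ℝ × ℝ)) ((hdc.mul hec).integrable_of_hasCompactSupport hds.mul_right)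
    (by
      simp only [he]
      exact (hd.continuous.mul (by fun_prop)).integrable_of_hasCompactSupport hs.mul_right)
    ((hd.continuous.mul hec).integrable_of_hasCompactSupport hs.mul_right)
    (fun ξ _ => hd.differentiable (by norm_num) ξ) (fun ξ _ => hed ξ)
  have k2 : ∫ ξ, fderiv ℝ h ξ (1, 0) * e ξ = Complex.I * x.1 * ∫ ξ, h ξ * e ξ := by
    rw [← neg_inj, ← key, ← neg_mul, ← integral_const_mul]
    congr 1 with ξ
    rw [he]
    ring
  unfold FT
  rw [k2]
  ring

/-- The function `x ↦ f(s x) φ(x)`, as a complex-valued function. -/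
def dilMul (f φ : ℝ × ℝ → ℝ) (s : ℝ) : ℝ × ℝ → ℂ := fun x => ((f (s * x.1, s * x.2) * φ x : ℝ) : ℂ)

theorem continuous_dilMul {f φ : ℝ × ℝ → ℝ} (hf : Continuous f) (hφ : Continuous φ) (s : ℝ) :
    Continuous (dilMul f φ s) := by
  unfold dilMul; fun_prop

theorem hasCompactSupport_dilMul (f : ℝ × ℝ → ℝ) {φ : ℝ × ℝ → ℝ} (hφ : HasCompactSupport φ)
    (s : ℝ) : HasCompactSupport (dilMul f φ s) :=
  hφ.mono fun x hx => by
    contrapose! hx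
    simp [dilMul, Function.notMem_support.1 hx]

theorem contDiff_dilMul {f φ : ℝ × ℝ → ℝ} (hf : ContDiff ℝ 1 f) (hφ : ContDiff ℝ 1 φ) (s : ℝ) :
    ContDiff ℝ 1 (dilMul f φ s) :=
  Complex.ofRealCLM.contDiff.comp ((hf.comp (by fun_prop)).mul hφ)

theorem fderiv_dilMul_fst {f φ : ℝ × ℝ → ℝ} (hf : ContDiff ℝ 1 f) (hφ : ContDiff ℝ 1 φ) (s : ℝ)
    (x : ℝ × ℝ) :
    fderiv ℝ (dilMul f φ s) x (1, 0) =
      s * dilMul (fun y => fderiv ℝ f y (1, 0)) φ s x +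
        dilMul f (fun y => fderiv ℝ φ y (1, 0)) s x := by
  have h1 : HasFDerivAt (fun y : ℝ × ℝ => (s * y.1, s * y.2))
      ((s • ContinuousLinearMap.fst ℝ ℝ ℝ).prod (s • ContinuousLinearMap.snd ℝ ℝ ℝ)) x :=
    (hasFDerivAt_fst.const_mul s).prodMk (hasFDerivAt_snd.const_mul s)
  have h2 := (hf.differentiable (by norm_num) (s * x.1, s * x.2)).hasFDerivAt.comp x h1
  have h3 := h2.mul (hφ.differentiable (by norm_num) x).hasFDerivAt
  have h4 : fderiv ℝ (dilMul f φ s) x = _ := (Complex.ofRealCLM.hasFDerivAt.comp x h3).fderiv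
  rw [h4]
  have h5 (L : ℝ × ℝ →L[ℝ] ℝ) : L (s, 0) = s * L (1, 0) := by
    rw [← smul_eq_mul, ← map_smul, Prod.smul_mk, smul_eq_mul, mul_one, smul_zero]
  simp [dilMul, h5 (fderiv ℝ f _)]
  ring

theorem FT_add {h k : ℝ × ℝ → ℂ} (hh : Integrable h) (hk : Integrable k) (x : ℝ × ℝ) :
    FT (fun ξ => h ξ + k ξ) x = FT h x + FT k x := by
  have hm : ∀ {h : ℝ × ℝ → ℂ}, Integrable h → Integrable fun ξ : ℝ × ℝ =>
      h ξ * Complex.exp (-(Complex.I) * ((ξ.1*x.1 + ξ.2*x.2 : ℝ) : ℂ)) := fun {h} hi =>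
    hi.mul_bdd (c := 1) (by fun_prop : Continuous _).aestronglyMeasurable
      (.of_forall fun ξ => (norm_exp_neg_I_mul _).le)
  unfold FT
  simp only [add_mul]
  rw [integral_add (hm hh) (hm hk), mul_add]

theorem FT_const_mul (c : ℂ) (h : ℝ × ℝ → ℂ) (x : ℝ × ℝ) :
    FT (fun ξ => c * h ξ) x = c * FT h x := by
  unfold FT
  simp only [mul_assoc]
  rw [integral_const_mul]
  ring

theorem mul_FT_dilMul_fst {f φ : ℝ × ℝ → ℝ} (hf : ContDiff ℝ 1 f) (hφ : ContDiff ℝ 1 φ)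
    (hs : HasCompactSupport φ) (s : ℝ) (x : ℝ × ℝ) :
    Complex.I * x.1 * FT (dilMul f φ s) x =
      s * FT (dilMul (fun y => fderiv ℝ f y (1, 0)) φ s) x +
        FT (dilMul f (fun y => fderiv ℝ φ y (1, 0)) s) x := by
  have hf' : Continuous fun y => fderiv ℝ f y (1, 0) :=
    (hf.continuous_fderiv (by norm_num)).clm_apply continuous_const
  have hφ' : Continuous fun y => fderiv ℝ φ y (1, 0) :=
    (hφ.continuous_fderiv (by norm_num)).clm_apply continuous_const
  rw [← FT_fderiv_fst (contDiff_dilMul hf hφ s) (hasCompactSupport_dilMul f hs s),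
    ← FT_const_mul, ← FT_add, funext (fderiv_dilMul_fst hf hφ s)]
  · exact (continuous_const.mul
      (continuous_dilMul hf' hφ.continuous s)).integrable_of_hasCompactSupport
      (hasCompactSupport_dilMul _ hs s).mul_left
  · exact (continuous_dilMul hf.continuous hφ' s).integrable_of_hasCompactSupport
      (hasCompactSupport_dilMul _ (hs.fderiv_apply ℝ _) s)

/-- The `L²` norms of the Fourier transforms of `f(s ·) φ` are bounded uniformly in `s ∈ (0, 1]`. -/
theorem exists_integral_norm_sq_FT_dilMul_le {f φ : ℝ × ℝ → ℝ} (hf : Continuous f)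
    (hφ : Continuous φ) (hs : HasCompactSupport φ) :
    ∃ C : ℝ, 0 ≤ C ∧ ∀ s : ℝ, 0 < s → s ≤ 1 → ∫ η, ‖FT (dilMul f φ s) η‖ ^ 2 ≤ C := by
  obtain ⟨R, hR⟩ := hs.isCompact.isBounded.subset_closedBall (0 : ℝ × ℝ)
  obtain ⟨M, hM⟩ := (isCompact_closedBall (0 : ℝ × ℝ) R).exists_bound_of_continuousOn
    hf.continuousOn
  have hi : Integrable fun x => (M * φ x) ^ 2 := by
    refine (by fun_prop : Continuous _).integrable_of_hasCompactSupport (hs.mono fun x hx => ?_)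
    contrapose! hx
    simp [Function.notMem_support.1 hx]
  refine ⟨((2 * π) ^ 2)⁻¹ * ∫ x, (M * φ x) ^ 2, ?_, fun s h0 h1 => ?_⟩
  · exact mul_nonneg (by positivity) (integral_nonneg fun x => sq_nonneg _)
  rw [(memLp_FT_and_integral_norm_sq (continuous_dilMul hf hφ s)
    (hasCompactSupport_dilMul f hs s)).2]
  refine mul_le_mul_of_nonneg_left ?_ (by positivity)
  refine integral_mono_of_nonneg (.of_forall fun x => by positivity) hi (.of_forall fun x => ?_)
  by_cases hx : x ∈ tsupport φ
  · have hx' : (s * x.1, s * x.2) ∈ Metric.closedBall (0 : ℝ × ℝ) R := by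
      have := hR hx
      rw [mem_closedBall_zero_iff] at this ⊢
      have e : (s * x.1, s * x.2) = s • x := rfl
      rw [e, norm_smul, Real.norm_of_nonneg h0.le]
      nlinarith [norm_nonneg x]
    have := hM _ hx'
    simp only [dilMul, Complex.norm_real]
    rw [← sq_abs (M * φ x), norm_mul, abs_mul]
    gcongr
    exacts [this.trans (le_abs_self M), le_rfl]
  · simp [dilMul, image_eq_zero_of_notMem_tsupport hx]

/-- Decay of the Fourier transform of `f(s ·) φ` with `f ∈ C^u` on the frequency range
`|η₁| ≥ 1 / (3 s)`: the squared `L²` norm is of order `s ^ (4 u)`. -/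
theorem exists_setIntegral_norm_sq_FT_dilMul_le (u : ℕ) : ∀ f : ℝ × ℝ → ℝ, ContDiff ℝ u f →
    ∀ φ : ℝ × ℝ → ℝ, ContDiff ℝ ∞ φ → HasCompactSupport φ →
    ∃ C : ℝ, 0 ≤ C ∧ ∀ s : ℝ, 0 < s → s ≤ 1 →
      ∫ η in {η : ℝ × ℝ | 1 / 3 ≤ s * |η.1|}, ‖FT (dilMul f φ s) η‖ ^ 2 ≤ C * s ^ (4 * u) := by
  have hsq : ∀ {f φ : ℝ × ℝ → ℝ}, Continuous f → Continuous φ → HasCompactSupport φ →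
      ∀ s, Integrable fun η => ‖FT (dilMul f φ s) η‖ ^ 2 := fun hf hφ hs s =>
    have := (memLp_FT_and_integral_norm_sq (continuous_dilMul hf hφ s)
      (hasCompactSupport_dilMul _ hs s)).1
    (memLp_two_iff_integrable_sq_norm this.1).1 this
  have hbase : ∀ f : ℝ × ℝ → ℝ, Continuous f →
      ∀ φ : ℝ × ℝ → ℝ, ContDiff ℝ ∞ φ → HasCompactSupport φ →
      ∃ C : ℝ, 0 ≤ C ∧ ∀ s : ℝ, 0 < s → s ≤ 1 →
        ∫ η in {η : ℝ × ℝ | 1 / 3 ≤ s * |η.1|}, ‖FT (dilMul f φ s) η‖ ^ 2 ≤ C := by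
    intro f hf φ hφ hs
    obtain ⟨C, hC, h⟩ := exists_integral_norm_sq_FT_dilMul_le hf hφ.continuous hs
    refine ⟨C, hC, fun s h0 h1 => le_trans ?_ (h s h0 h1)⟩
    exact setIntegral_le_integral (hsq hf hφ.continuous hs s) (.of_forall fun η => by positivity)
  induction u with
  | zero =>
    intro f hf φ hφ hs
    simpa using hbase f hf.continuous φ hφ hs
  | succ u ih =>
    intro f hf
    have hf1 : ContDiff ℝ 1 f := hf.of_le (by norm_cast; omega)
    have hf' : ContDiff ℝ u fun y => fderiv ℝ f y (1, 0) :=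
      (hf.fderiv_right (by norm_cast)).clm_apply contDiff_const
    have main : ∀ k ≤ 2 * u + 2, ∀ φ : ℝ × ℝ → ℝ, ContDiff ℝ ∞ φ → HasCompactSupport φ →
        ∃ C : ℝ, 0 ≤ C ∧ ∀ s : ℝ, 0 < s → s ≤ 1 →
        ∫ η in {η : ℝ × ℝ | 1 / 3 ≤ s * |η.1|}, ‖FT (dilMul f φ s) η‖ ^ 2 ≤ C * s ^ (2 * k) := by
      intro k
      induction k with
      | zero =>
        intro _ φ hφ hs
        simpa using hbase f hf.continuous φ hφ hs
      | succ k ihk =>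
        intro hk φ hφ hs
        have hφ' : ContDiff ℝ ∞ fun y => fderiv ℝ φ y (1, 0) :=
          (hφ.fderiv_right (by simp)).clm_apply contDiff_const
        have hs' : HasCompactSupport fun y => fderiv ℝ φ y (1, 0) := hs.fderiv_apply ℝ _
        obtain ⟨C1, hC1, h1⟩ := ih _ hf' φ hφ hs
        obtain ⟨C2, hC2, h2⟩ := ihk (by omega) _ hφ' hs'
        refine ⟨18 * (C1 + C2), by positivity, fun s s0 s1 => ?_⟩
        set S := {η : ℝ × ℝ | 1 / 3 ≤ s * |η.1|}
        have hS : MeasurableSet S := measurableSet_le (by fun_prop) (by fun_prop)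
        have i1 := hsq hf'.continuous hφ.continuous hs s
        have i2 := hsq hf.continuous hφ'.continuous hs' s
        calc ∫ η in S, ‖FT (dilMul f φ s) η‖ ^ 2
            ≤ ∫ η in S, (18 * s ^ 4 * ‖FT (dilMul (fun y => fderiv ℝ f y (1, 0)) φ s) η‖ ^ 2 +
              18 * s ^ 2 * ‖FT (dilMul f (fun y => fderiv ℝ φ y (1, 0)) s) η‖ ^ 2) := by
              refine setIntegral_mono_on (hsq hf.continuous hφ.continuous hs s).integrableOn
                ((i1.const_mul _).add (i2.const_mul _)).integrableOn hS fun η hη => ?_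
              have e := congrArg norm
                (mul_FT_dilMul_fst hf1 (hφ.of_le (by norm_cast)) hs s η)
              rw [norm_mul, norm_mul, Complex.norm_I, one_mul, Complex.norm_real,
                Real.norm_eq_abs] at e
              have e2 := (norm_add_le (s * FT (dilMul (fun y => fderiv ℝ f y (1, 0)) φ s) η)
                (FT (dilMul f (fun y => fderiv ℝ φ y (1, 0)) s) η))
              rw [← e, norm_mul, Complex.norm_real, Real.norm_of_nonneg s0.le] at e2
              set A := ‖FT (dilMul (fun y => fderiv ℝ f y (1, 0)) φ s) η‖
              set B := ‖FT (dilMul f (fun y => fderiv ℝ φ y (1, 0)) s) η‖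
              have hη' : 1 / 3 ≤ s * |η.1| := hη
              have e3 : ‖FT (dilMul f φ s) η‖ ≤ 3 * s * (s * A + B) := by
                have : (1 / 3) * ‖FT (dilMul f φ s) η‖ ≤ s * |η.1| * ‖FT (dilMul f φ s) η‖ := by
                  gcongr
                nlinarith
              calc ‖FT (dilMul f φ s) η‖ ^ 2 ≤ (3 * s * (s * A + B)) ^ 2 := by gcongr
                _ ≤ _ := by nlinarith [mul_nonneg (sq_nonneg s) (sq_nonneg (s * A - B))]
          _ = 18 * s ^ 4 * (∫ η in S, ‖FT (dilMul (fun y => fderiv ℝ f y (1, 0)) φ s) η‖ ^ 2) +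
              18 * s ^ 2 * ∫ η in S, ‖FT (dilMul f (fun y => fderiv ℝ φ y (1, 0)) s) η‖ ^ 2 := by
              rw [integral_add (i1.const_mul _).integrableOn (i2.const_mul _).integrableOn,
                integral_const_mul, integral_const_mul]
          _ ≤ 18 * s ^ 4 * (C1 * s ^ (4 * u)) + 18 * s ^ 2 * (C2 * s ^ (2 * k)) := by
              gcongr
              exacts [h1 s s0 s1, h2 s s0 s1]
          _ = 18 * C1 * s ^ (4 * u + 4) + 18 * C2 * s ^ (2 * (k + 1)) := by ring
          _ ≤ 18 * C1 * s ^ (2 * (k + 1)) + 18 * C2 * s ^ (2 * (k + 1)) := by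
              gcongr 18 * C1 * ?_ + _
              exact pow_le_pow_of_le_one s0.le s1 (by omega)
          _ = _ := by ring
    intro φ hφ hs
    obtain ⟨C, hC, h⟩ := main (2 * u + 2) le_rfl φ hφ hs
    exact ⟨C, hC, fun s s0 s1 => (h s s0 s1).trans_eq (by ring_nf)⟩

/-- Families `(s, a) ↦ E s a` of functions on `ℝ²` that are finite sums of terms
`c(s, a) 𝓕[f(s ·) φ](η) G₁(s η₁) G₂(η₂ - a η₁)` with bounded coefficients `c`, smooth `φ`, and
compactly supported windows `G₁, G₂ ∈ C^n`, where `G₁` vanishes on `(-1/3, 1/3)`. -/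
inductive ShearSum (f : ℝ × ℝ → ℝ) (n : ℕ) : (ℝ → ℝ → ℝ × ℝ → ℂ) → Prop
  | term (φ : ℝ × ℝ → ℝ) (G₁ G₂ : ℝ → ℝ) (c : ℝ → ℝ → ℂ)
      (hφ : ContDiff ℝ ∞ φ) (hs : HasCompactSupport φ)
      (hG₁ : ContDiff ℝ n G₁) (hG₂ : ContDiff ℝ n G₂)
      (hs₁ : HasCompactSupport G₁) (hs₂ : HasCompactSupport G₂)
      (hv : ∀ x, |x| < 1 / 3 → G₁ x = 0)
      (hc : ∀ s a, 0 < s → s ≤ 1 → |a| ≤ 1 → ‖c s a‖ ≤ 1) :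
      ShearSum f n fun s a η => c s a * FT (dilMul f φ s) η *
        ((G₁ (s * η.1) * G₂ (η.2 - a * η.1) : ℝ) : ℂ)
  | add {E F : ℝ → ℝ → ℝ × ℝ → ℂ} : ShearSum f n E → ShearSum f n F →
      ShearSum f n fun s a η => E s a η + F s a η

theorem hasDerivAt_FT_dilMul_fst {f φ : ℝ × ℝ → ℝ} (hf : Continuous f) (hφ : Continuous φ)
    (hs : HasCompactSupport φ) (s x y : ℝ) :
    HasDerivAt (fun t => FT (dilMul f φ s) (t, y))
      (-Complex.I * FT (dilMul f (fun ξ => ξ.1 * φ ξ) s) (x, y)) x := by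
  convert! hasDerivAt_FT_fst (continuous_dilMul hf hφ s) (hasCompactSupport_dilMul f hs s) x y
    using 4 with ξ
  simp [dilMul]
  ring

theorem hasDerivAt_FT_dilMul_snd {f φ : ℝ × ℝ → ℝ} (hf : Continuous f) (hφ : Continuous φ)
    (hs : HasCompactSupport φ) (s x y : ℝ) :
    HasDerivAt (fun t => FT (dilMul f φ s) (x, t))
      (-Complex.I * FT (dilMul f (fun ξ => ξ.2 * φ ξ) s) (x, y)) y := by
  convert! hasDerivAt_FT_snd (continuous_dilMul hf hφ s) (hasCompactSupport_dilMul f hs s) x y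
    using 4 with ξ
  simp [dilMul]
  ring

theorem deriv_eq_zero_of_abs_lt {G : ℝ → ℝ} {r : ℝ} (hv : ∀ x, |x| < r → G x = 0) (x : ℝ)
    (hx : |x| < r) : deriv G x = 0 := by
  have : G =ᶠ[nhds x] fun _ => 0 := by
    filter_upwards [(isOpen_lt continuous_abs continuous_const).mem_nhds hx] with y hy
    exact hv y hy
  rw [this.deriv_eq, deriv_const]

theorem ShearSum.exists_hasDerivAt_fst {f : ℝ × ℝ → ℝ} (hf : Continuous f) {n : ℕ}
    {E : ℝ → ℝ → ℝ × ℝ → ℂ} (hE : ShearSum f (n + 1) E) :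
    ∃ E', ShearSum f n E' ∧ ∀ s a x y, HasDerivAt (fun t => E s a (t, y)) (E' s a (x, y)) x := by
  induction hE with
  | term φ G₁ G₂ c hφ hs hG₁ hG₂ hs₁ hs₂ hv hc =>
    have d₁ : ContDiff ℝ n (deriv G₁) := (contDiff_succ_iff_deriv.1 (by exact_mod_cast hG₁)).2.2
    have d₂ : ContDiff ℝ n (deriv G₂) := (contDiff_succ_iff_deriv.1 (by exact_mod_cast hG₂)).2.2
    have l₁ : ContDiff ℝ n G₁ := hG₁.of_le (by norm_cast; omega)
    have l₂ : ContDiff ℝ n G₂ := hG₂.of_le (by norm_cast; omega)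
    refine ⟨_, .add (.add
      (.term (fun ξ => ξ.1 * φ ξ) G₁ G₂ (fun s a => -Complex.I * c s a) (contDiff_fst.mul hφ)
        hs.mul_left l₁ l₂ hs₁ hs₂ hv ?_)
      (.term φ (deriv G₁) G₂ (fun s a => s * c s a) hφ hs d₁ l₂ hs₁.deriv hs₂
        (deriv_eq_zero_of_abs_lt hv) ?_))
      (.term φ G₁ (deriv G₂) (fun s a => -a * c s a) hφ hs l₁ d₂ hs₁ hs₂.deriv hv ?_), ?_⟩
    · intro s a h0 h1 ha
      simpa using hc s a h0 h1 ha
    · intro s a h0 h1 ha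
      rw [norm_mul, Complex.norm_real, Real.norm_of_nonneg h0.le]
      exact mul_le_one₀ h1 (norm_nonneg _) (hc s a h0 h1 ha)
    · intro s a h0 h1 ha
      rw [norm_mul, norm_neg, Complex.norm_real, Real.norm_eq_abs]
      exact mul_le_one₀ ha (norm_nonneg _) (hc s a h0 h1 ha)
    · intro s a x y
      have g₁ : HasDerivAt (fun t => G₁ (s * t)) (deriv G₁ (s * x) * s) x :=
        ((hG₁.differentiable (by norm_cast)) (s * x)).hasDerivAt.comp x
          (by simpa using (hasDerivAt_id x).const_mul s)
      have g₂ : HasDerivAt (fun t => G₂ (y - a * t)) (deriv G₂ (y - a * x) * (-a)) x :=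
        ((hG₂.differentiable (by norm_cast)) (y - a * x)).hasDerivAt.comp x
          (by simpa using ((hasDerivAt_id x).const_mul a).const_sub y)
      convert! ((hasDerivAt_FT_dilMul_fst hf hφ.continuous hs s x y).const_mul (c s a)).mul
        (g₁.mul g₂).ofReal_comp using 1
      simp only [Pi.mul_apply]
      push_cast
      ring
  | add _ _ ih₁ ih₂ =>
    obtain ⟨E', hE', h₁⟩ := ih₁
    obtain ⟨F', hF', h₂⟩ := ih₂
    exact ⟨_, hE'.add hF', fun s a x y => (h₁ s a x y).add (h₂ s a x y)⟩

theorem ShearSum.exists_hasDerivAt_snd {f : ℝ × ℝ → ℝ} (hf : Continuous f) {n : ℕ}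
    {E : ℝ → ℝ → ℝ × ℝ → ℂ} (hE : ShearSum f (n + 1) E) :
    ∃ E', ShearSum f n E' ∧ ∀ s a x y, HasDerivAt (fun t => E s a (x, t)) (E' s a (x, y)) y := by
  induction hE with
  | term φ G₁ G₂ c hφ hs hG₁ hG₂ hs₁ hs₂ hv hc =>
    have d₂ : ContDiff ℝ n (deriv G₂) := (contDiff_succ_iff_deriv.1 (by exact_mod_cast hG₂)).2.2
    have l₁ : ContDiff ℝ n G₁ := hG₁.of_le (by norm_cast; omega)
    have l₂ : ContDiff ℝ n G₂ := hG₂.of_le (by norm_cast; omega)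
    refine ⟨_, .add
      (.term (fun ξ => ξ.2 * φ ξ) G₁ G₂ (fun s a => -Complex.I * c s a) (contDiff_snd.mul hφ)
        hs.mul_left l₁ l₂ hs₁ hs₂ hv ?_)
      (.term φ G₁ (deriv G₂) c hφ hs l₁ d₂ hs₁ hs₂.deriv hv hc), ?_⟩
    · intro s a h0 h1 ha
      simpa using hc s a h0 h1 ha
    · intro s a x y
      have g₂ : HasDerivAt (fun t => G₂ (t - a * x)) (deriv G₂ (y - a * x)) y :=
        ((hG₂.differentiable (by norm_cast)) (y - a * x)).hasDerivAt.comp_sub_const y (a * x)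
      convert! ((hasDerivAt_FT_dilMul_snd hf hφ.continuous hs s x y).const_mul (c s a)).mul
        (g₂.const_mul (G₁ (s * x))).ofReal_comp using 1
      push_cast
      ring
  | add _ _ ih₁ ih₂ =>
    obtain ⟨E', hE', h₁⟩ := ih₁
    obtain ⟨F', hF', h₂⟩ := ih₂
    exact ⟨_, hE'.add hF', fun s a x y => (h₁ s a x y).add (h₂ s a x y)⟩

theorem ShearSum.pd1_iterate {f : ℝ × ℝ → ℝ} (hf : Continuous f) {n k : ℕ}
    {E : ℝ → ℝ → ℝ × ℝ → ℂ} (hE : ShearSum f (n + k) E) :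
    ShearSum f n fun s a => pd1^[k] (E s a) := by
  induction k generalizing E with
  | zero => exact hE
  | succ k ih =>
    obtain ⟨E', hE', h⟩ := exists_hasDerivAt_fst hf (n := n + k) hE
    have : E' = fun s a => pd1 (E s a) := by
      funext s a η
      exact (h s a η.1 η.2).deriv.symm
    exact ih (this ▸ hE')

theorem ShearSum.pd2_iterate {f : ℝ × ℝ → ℝ} (hf : Continuous f) {n k : ℕ}
    {E : ℝ → ℝ → ℝ × ℝ → ℂ} (hE : ShearSum f (n + k) E) :
    ShearSum f n fun s a => pd2^[k] (E s a) := by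
  induction k generalizing E with
  | zero => exact hE
  | succ k ih =>
    obtain ⟨E', hE', h⟩ := exists_hasDerivAt_snd hf (n := n + k) hE
    have : E' = fun s a => pd2 (E s a) := by
      funext s a η
      exact (h s a η.1 η.2).deriv.symm
    exact ih (this ▸ hE')

theorem ShearSum.exists_integral_norm_sq_le {u : ℕ} {f : ℝ × ℝ → ℝ} (hf : ContDiff ℝ u f) {n : ℕ}
    {E : ℝ → ℝ → ℝ × ℝ → ℂ} (hE : ShearSum f n E) :
    ∃ C : ℝ, 0 ≤ C ∧ ∀ s a, 0 < s → s ≤ 1 → |a| ≤ 1 →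
      MemLp (E s a) 2 ∧ ∫ η, ‖E s a η‖ ^ 2 ≤ C * s ^ (4 * u) := by
  induction hE with
  | term φ G₁ G₂ c hφ hs hG₁ hG₂ hs₁ hs₂ hv hc =>
    obtain ⟨C, hC, h⟩ := exists_setIntegral_norm_sq_FT_dilMul_le u f hf φ hφ hs
    obtain ⟨M₁, hM₁⟩ := hs₁.exists_bound_of_continuous hG₁.continuous
    obtain ⟨M₂, hM₂⟩ := hs₂.exists_bound_of_continuous hG₂.continuous
    have hM₁' : 0 ≤ M₁ := (norm_nonneg _).trans (hM₁ 0)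
    have hM₂' : 0 ≤ M₂ := (norm_nonneg _).trans (hM₂ 0)
    refine ⟨(M₁ * M₂) ^ 2 * C, by positivity, fun s a h0 h1 ha => ?_⟩
    have hcF := continuous_dilMul hf.continuous hφ.continuous s
    have hsF := hasCompactSupport_dilMul f hs s
    have hm := (memLp_FT_and_integral_norm_sq hcF hsF).1
    have hFT : Continuous (FT (dilMul f φ s)) :=
      continuous_FT (hcF.integrable_of_hasCompactSupport hsF)
    have c₁ := hG₁.continuous
    have c₂ := hG₂.continuous
    set D : ℝ × ℝ → ℂ := fun η => c s a * FT (dilMul f φ s) η *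
        ((G₁ (s * η.1) * G₂ (η.2 - a * η.1) : ℝ) : ℂ) with hD
    have hb : ∀ η, ‖D η‖ ≤ M₁ * M₂ * ‖FT (dilMul f φ s) η‖ := by
      intro η
      rw [hD]
      simp only [norm_mul, Complex.norm_real]
      calc _ ≤ 1 * ‖FT (dilMul f φ s) η‖ * (M₁ * M₂) := by
            gcongr
            exacts [hc s a h0 h1 ha, hM₁ _, hM₂ _]
        _ = _ := by ring
    have hDm : MemLp D 2 :=
      hm.of_le_mul (by fun_prop : Continuous D).aestronglyMeasurable (.of_forall hb)
    refine ⟨hDm, ?_⟩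
    rw [← setIntegral_eq_integral_of_forall_compl_eq_zero
      (s := {η : ℝ × ℝ | 1 / 3 ≤ s * |η.1|})]
    · calc _ ≤ ∫ η in {η : ℝ × ℝ | 1 / 3 ≤ s * |η.1|},
            (M₁ * M₂) ^ 2 * ‖FT (dilMul f φ s) η‖ ^ 2 := by
            refine setIntegral_mono ((memLp_two_iff_integrable_sq_norm hDm.1).1 hDm).integrableOn
              (((memLp_two_iff_integrable_sq_norm hm.1).1 hm).const_mul _).integrableOn fun η => ?_
            rw [← mul_pow]
            exact pow_le_pow_left₀ (norm_nonneg _) (hb η) 2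
        _ ≤ _ := by
            rw [integral_const_mul, mul_assoc]
            exact mul_le_mul_of_nonneg_left (h s h0 h1) (by positivity)
    · intro η hη
      have : G₁ (s * η.1) = 0 := hv _ (by
        rw [abs_mul, abs_of_pos h0]
        exact not_le.1 hη)
      simp [this]
  | @add E F _ _ ih₁ ih₂ =>
    obtain ⟨C₁, hC₁, h₁⟩ := ih₁
    obtain ⟨C₂, hC₂, h₂⟩ := ih₂
    refine ⟨2 * (C₁ + C₂), by positivity, fun s a h0 h1 ha => ?_⟩
    obtain ⟨m₁, b₁⟩ := h₁ s a h0 h1 ha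
    obtain ⟨m₂, b₂⟩ := h₂ s a h0 h1 ha
    have i₁ := (memLp_two_iff_integrable_sq_norm m₁.1).1 m₁
    have i₂ := (memLp_two_iff_integrable_sq_norm m₂.1).1 m₂
    have m := m₁.add m₂
    refine ⟨m, ?_⟩
    calc _ ≤ ∫ η, (2 * ‖E s a η‖ ^ 2 + 2 * ‖F s a η‖ ^ 2) := by
          refine integral_mono ((memLp_two_iff_integrable_sq_norm m.1).1 m)
            ((i₁.const_mul 2).add (i₂.const_mul 2)) fun η => ?_
          have := norm_add_le (E s a η) (F s a η)
          calc ‖E s a η + F s a η‖ ^ 2 ≤ (‖E s a η‖ + ‖F s a η‖) ^ 2 := by gcongr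
            _ ≤ _ := by nlinarith [sq_nonneg (‖E s a η‖ - ‖F s a η‖)]
      _ = 2 * (∫ η, ‖E s a η‖ ^ 2) + 2 * ∫ η, ‖F s a η‖ ^ 2 := by
          rw [integral_add (i₁.const_mul 2) (i₂.const_mul 2), integral_const_mul,
            integral_const_mul]
      _ ≤ _ := by linarith

theorem IsWindow.hasCompactSupport {g : ℝ → ℝ} (hg : IsWindow g) : HasCompactSupport g :=
  .of_support_subset_isCompact isCompact_Icc (hg.supp_eq.trans_subset Ioo_subset_Icc_self)

theorem IsWindow.eq_one_of_abs_lt {g : ℝ → ℝ} (hg : IsWindow g) {x : ℝ} (hx : |x| < 1 / 3) :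
    g x = 1 := by
  rw [abs_lt] at hx
  have h : HasSum (fun z : ℤ => g (x + z)) (g (x + (0 : ℤ))) := by
    refine hasSum_single 0 fun z hz => ?_
    rw [← Function.notMem_support, hg.supp_eq, mem_Ioo]
    rintro ⟨h₁, h₂⟩
    rcases lt_or_gt_of_ne hz with h | h
    · have : (z : ℝ) ≤ -1 := by exact_mod_cast (by omega : z ≤ -1)
      linarith
    · have : (1 : ℝ) ≤ z := by exact_mod_cast (by omega : 1 ≤ z)
      linarith
  simpa using h.unique (hg.partition x)

theorem IsWindow.gtilde_eq_zero {g : ℝ → ℝ} (hg : IsWindow g) (x : ℝ) (hx : |x| < 1 / 3) :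
    gtilde g x = 0 := by
  have h : |x / 2| < 1 / 3 := by
    rw [abs_div, abs_two]
    linarith [abs_nonneg x]
  rw [gtilde, hg.eq_one_of_abs_lt hx, hg.eq_one_of_abs_lt h, sub_self]

theorem IsWindow.hasCompactSupport_gtilde {g : ℝ → ℝ} (hg : IsWindow g) :
    HasCompactSupport (gtilde g) := by
  refine .of_support_subset_isCompact (isCompact_Icc (a := -(4 / 3)) (b := 4 / 3)) fun x hx => ?_
  contrapose! hx
  have h : ∀ y, |x| ≤ 2 * |y| → g y = 0 := fun y hy => by
    rw [← Function.notMem_support, hg.supp_eq, mem_Ioo, ← abs_lt]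
    rw [mem_Icc, ← abs_le] at hx
    linarith
  rw [Function.notMem_support, gtilde, h, h, sub_self]
  · linarith [abs_nonneg x]
  · rw [abs_div, abs_two]
    linarith

theorem IsWindowQ.contDiff_gtilde {g : ℝ → ℝ} {q : ℕ} (hg : IsWindowQ g q) :
    ContDiff ℝ q (gtilde g) :=
  (hg.2.comp (contDiff_id.div_const 2)).sub hg.2

theorem FT_mul_comp_inv_smul (f φ : ℝ × ℝ → ℝ) {s : ℝ} (hs : 0 < s) (z : ℝ × ℝ) :
    FT (fun x => ((f x * φ (s⁻¹ * x.1, s⁻¹ * x.2) : ℝ) : ℂ)) z =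
      s ^ 2 * FT (dilMul f φ s) (s * z.1, s * z.2) := by
  have h := Measure.integral_comp_smul volume (fun η : ℝ × ℝ => dilMul f φ s η *
    Complex.exp (-(Complex.I) * ((η.1 * (s * z.1) + η.2 * (s * z.2) : ℝ) : ℂ))) s⁻¹
  have hdim : Module.finrank ℝ (ℝ × ℝ) = 2 := by simp
  rw [hdim, abs_of_pos (by positivity), inv_pow, inv_inv, Complex.real_smul, Complex.ofReal_pow]
    at h
  unfold FT
  rw [mul_left_comm, ← h]
  congr 2 with x
  simp only [dilMul, Prod.smul_fst, Prod.smul_snd, smul_eq_mul]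
  rw [mul_inv_cancel_left₀ hs.ne', mul_inv_cancel_left₀ hs.ne']
  congr 5 <;> field_simp

theorem pd1_iterate_dilate (c : ℂ) (s : ℝ) (D : ℝ × ℝ → ℂ) (k : ℕ) :
    pd1^[k] (fun z => c * D (s * z.1, s * z.2)) =
      fun z => c * s ^ k * pd1^[k] D (s * z.1, s * z.2) := by
  induction k generalizing c D with
  | zero => simp
  | succ k ih =>
    have h : pd1 (fun z => c * D (s * z.1, s * z.2)) =
        fun z => c * s * pd1 D (s * z.1, s * z.2) := by
      funext z
      simp only [pd1]
      rw [deriv_const_mul_field, deriv_comp_mul_left s (fun t => D (t, s * z.2)),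
        Complex.real_smul, mul_assoc]
    rw [Function.iterate_succ_apply, h, ih]
    funext z
    rw [Function.iterate_succ_apply, pow_succ', mul_assoc c]

theorem pd2_iterate_dilate (c : ℂ) (s : ℝ) (D : ℝ × ℝ → ℂ) (k : ℕ) :
    pd2^[k] (fun z => c * D (s * z.1, s * z.2)) =
      fun z => c * s ^ k * pd2^[k] D (s * z.1, s * z.2) := by
  induction k generalizing c D with
  | zero => simp
  | succ k ih =>
    have h : pd2 (fun z => c * D (s * z.1, s * z.2)) =
        fun z => c * s * pd2 D (s * z.1, s * z.2) := by
      funext z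
      simp only [pd2]
      rw [deriv_const_mul_field, deriv_comp_mul_left s (fun t => D (s * z.1, t)),
        Complex.real_smul, mul_assoc]
    rw [Function.iterate_succ_apply, h, ih]
    funext z
    rw [Function.iterate_succ_apply, pow_succ', mul_assoc c]

theorem pd1_iterate_comp_swap (D : ℝ × ℝ → ℂ) (k : ℕ) :
    pd1^[k] (fun z => D z.swap) = fun z => pd2^[k] D z.swap := by
  induction k generalizing D with
  | zero => rfl
  | succ k ih => exact ih (pd2 D)

theorem pd2_iterate_comp_swap (D : ℝ × ℝ → ℂ) (k : ℕ) :
    pd2^[k] (fun z => D z.swap) = fun z => pd1^[k] D z.swap := by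
  induction k generalizing D with
  | zero => rfl
  | succ k ih => exact ih (pd1 D)

theorem ShearSum.exists_integral_norm_sq_dilate_le {u : ℕ} {f : ℝ × ℝ → ℝ} (hf : ContDiff ℝ u f)
    {n : ℕ} {E : ℝ → ℝ → ℝ × ℝ → ℂ} (hE : ShearSum f n E) (k : ℕ) :
    ∃ C : ℝ, 0 ≤ C ∧ ∀ s a : ℝ, 0 < s → s ≤ 1 → |a| ≤ 1 →
      ∫ z : ℝ × ℝ, ‖(s : ℂ) ^ (2 + k) * E s a (s * z.1, s * z.2)‖ ^ 2 ≤
        C * s ^ (4 * u + 2 + 2 * k) := by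
  obtain ⟨C, hC, h⟩ := hE.exists_integral_norm_sq_le hf
  refine ⟨C, hC, fun s a h0 h1 ha => ?_⟩
  have hi := Measure.integral_comp_smul volume (fun η : ℝ × ℝ => ‖E s a η‖ ^ 2) s
  have hdim : Module.finrank ℝ (ℝ × ℝ) = 2 := by simp
  rw [hdim, abs_of_pos (by positivity), smul_eq_mul] at hi
  simp only [norm_mul, norm_pow, Complex.norm_real, mul_pow, Real.norm_of_nonneg h0.le]
  rw [integral_const_mul]
  calc _ = ((s ^ (2 + k)) ^ 2) * ((s ^ 2)⁻¹ * ∫ η, ‖E s a η‖ ^ 2) := by rw [← hi]; rfl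
    _ ≤ ((s ^ (2 + k)) ^ 2) * ((s ^ 2)⁻¹ * (C * s ^ (4 * u))) := by
        gcongr
        exact (h s a h0 h1 ha).2
    _ = _ := by
        field_simp
        ring

/-- The estimate for the horizontal windows, with the partial derivatives taken in either order. -/
theorem exists_integral_norm_sq_iterate_le {u : ℕ} {f : ℝ × ℝ → ℝ} (hf : ContDiff ℝ u f)
    {φ : ℝ × ℝ → ℝ} (hφ : ContDiff ℝ ∞ φ) (hs : HasCompactSupport φ) {g : ℝ → ℝ} {q : ℕ}
    (hg : IsWindowQ g q) {m n : ℕ} (hmn : m + n ≤ q) :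
    ∃ C : ℝ, 0 ≤ C ∧ ∀ (s a : ℝ) (P : ℝ × ℝ → ℂ), 0 < s → s ≤ 1 → |a| ≤ 1 →
      (∀ z, P z = FT (fun x => ((f x * φ (s⁻¹ * x.1, s⁻¹ * x.2) : ℝ) : ℂ)) z *
        ((gtilde g (s * (s * z.1)) * g (s * z.2 - a * (s * z.1)) : ℝ) : ℂ)) →
      ∫ ξ, ‖pd1^[m] (pd2^[n] P) ξ‖ ^ 2 ≤ C * s ^ (4 * u + 2 + 2 * (m + n)) ∧
      ∫ ξ, ‖pd2^[n] (pd1^[m] P) ξ‖ ^ 2 ≤ C * s ^ (4 * u + 2 + 2 * (m + n)) := by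
  have hE : ShearSum f (m + n) fun s a η => 1 * FT (dilMul f φ s) η *
      ((gtilde g (s * η.1) * g (η.2 - a * η.1) : ℝ) : ℂ) :=
    .term φ (gtilde g) g (fun _ _ => 1) hφ hs (hg.contDiff_gtilde.of_le (by exact_mod_cast hmn))
      (hg.2.of_le (by exact_mod_cast hmn)) hg.1.hasCompactSupport_gtilde hg.1.hasCompactSupport
      hg.1.gtilde_eq_zero (by simp)
  set E : ℝ → ℝ → ℝ × ℝ → ℂ := fun s a η => 1 * FT (dilMul f φ s) η *
      ((gtilde g (s * η.1) * g (η.2 - a * η.1) : ℝ) : ℂ) with hE_def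
  have h₁ : ShearSum f 0 fun s a => pd1^[m] (pd2^[n] (E s a)) := by
    have := hE.pd2_iterate hf.continuous
    rw [← zero_add m] at this
    exact this.pd1_iterate hf.continuous
  have h₂ : ShearSum f 0 fun s a => pd2^[n] (pd1^[m] (E s a)) := by
    rw [add_comm] at hE
    have := hE.pd1_iterate hf.continuous
    rw [← zero_add n] at this
    exact this.pd2_iterate hf.continuous
  obtain ⟨C₁, hC₁, b₁⟩ := h₁.exists_integral_norm_sq_dilate_le hf (m + n)
  obtain ⟨C₂, hC₂, b₂⟩ := h₂.exists_integral_norm_sq_dilate_le hf (m + n)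
  refine ⟨C₁ + C₂, by positivity, fun s a P h0 h1 ha hP => ?_⟩
  have hP' : P = fun z => (s : ℂ) ^ 2 * E s a (s * z.1, s * z.2) := by
    funext z
    rw [hP, FT_mul_comp_inv_smul f φ h0]
    simp only [hE_def]
    ring
  have hle : ∀ {C : ℝ}, C ≤ C₁ + C₂ → C * s ^ (4 * u + 2 + 2 * (m + n)) ≤
      (C₁ + C₂) * s ^ (4 * u + 2 + 2 * (m + n)) := fun h => by gcongr
  constructor
  · have := (b₁ s a h0 h1 ha).trans (hle (by linarith))
    rw [hP', pd2_iterate_dilate, pd1_iterate_dilate]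
    convert! this using 6
    ring
  · have := (b₂ s a h0 h1 ha).trans (hle (by linarith))
    rw [hP', pd1_iterate_dilate, pd2_iterate_dilate]
    convert! this using 6
    ring

/-- For `f ∈ C^u(ℝ²)`, `f_j = f·φ_j` and `Ψ^{(i)} ∈ 𝒲₂^q` with `q ≥ 2`,
`‖∂^r[𝓕[f_j]·Ψ_{j,ℓ}^{(i)}]‖²_{L₂(ℝ²)} ≤ C(u,q) 2^{-j(2u+1+|r|₁)}` for `|r|₁ ≤ q`. -/
theorem norm_FT_fj_Psi_bound (u : ℕ) (hu : 1 ≤ u) (f : ℝ × ℝ → ℝ) (hf : ContDiff ℝ u f)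
    (φ : ℝ × ℝ → ℝ) (hφ : ContDiff ℝ (⊤ : ℕ∞) φ)
    (hφs : tsupport φ ⊆ Icc (-π) π ×ˢ Icc (-π) π)
    (g : ℝ → ℝ) (q : ℕ) (hq : 2 ≤ q) (hg : IsWindowQ g q) (i : Bool)
    (r : ℕ × ℕ) (hr : r.1 + r.2 ≤ q) :
    ∃ C > 0, ∀ j : ℕ, Even j → 10 ≤ j → ∀ ℓ : ℤ, |(ℓ : ℝ)| ≤ (2:ℝ)^((j:ℝ)/2) →
      (∫ ξ : ℝ × ℝ,
          ‖pd r (fun z =>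
              FT (fun x =>
                ((f x * φ ((2:ℝ)^((j:ℝ)/2)*x.1, (2:ℝ)^((j:ℝ)/2)*x.2) : ℝ) : ℂ)) z
              * (PsiJL g i j ℓ z : ℂ)) ξ‖^2)
        ≤ C * (2:ℝ)^(-(j:ℝ)*(2*(u:ℝ)+1+(r.1:ℝ)+(r.2:ℝ))) := by
  have hs : HasCompactSupport φ := (isCompact_Icc.prod isCompact_Icc).of_isClosed_subset
    (isClosed_tsupport φ) hφs
  have hscale (j : ℕ) : ∃ s : ℝ, 0 < s ∧ s ≤ 1 ∧ (2 : ℝ) ^ (-(j : ℝ) / 2) = s ∧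
      (2 : ℝ) ^ ((j : ℝ) / 2) = s⁻¹ ∧ (2 : ℝ) ^ (-(j : ℝ)) = s * s ∧
      (2 : ℝ) ^ (-(j : ℝ) * (2 * (u : ℝ) + 1 + (r.1 : ℝ) + (r.2 : ℝ))) =
        s ^ (4 * u + 2 + 2 * (r.1 + r.2)) := by
    refine ⟨_, by positivity, ?_, rfl, ?_, ?_, ?_⟩
    · refine rpow_le_one_of_one_le_of_nonpos one_le_two ?_
      linarith [(Nat.cast_nonneg j : (0 : ℝ) ≤ j)]
    · rw [← rpow_neg two_pos.le]
      congr 1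
      ring
    · rw [← rpow_add two_pos]
      congr 1
      ring
    · rw [← rpow_natCast, ← rpow_mul two_pos.le]
      congr 1
      push_cast
      ring
  cases i with
  | true =>
    obtain ⟨C, hC, h⟩ := exists_integral_norm_sq_iterate_le hf hφ hs hg hr
    refine ⟨C + 1, by positivity, fun j _ _ ℓ hℓ => ?_⟩
    obtain ⟨s, h0, h1, e₁, e₂, e₃, e₄⟩ := hscale j
    rw [e₂] at hℓ ⊢
    rw [e₄]
    have ha : |(ℓ : ℝ) * s| ≤ 1 := by
      rw [abs_mul, abs_of_pos h0]
      exact (mul_le_mul_of_nonneg_right hℓ h0.le).trans_eq (inv_mul_cancel₀ h0.ne')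
    refine (h s (ℓ * s) _ h0 h1 ha fun z => ?_).1.trans (by gcongr; linarith)
    simp only [PsiJL, PsiH, e₁, e₃, if_true]
    congr 4 <;> ring_nf
  | false =>
    have hsw : ContDiff ℝ ∞ (Prod.swap : ℝ × ℝ → ℝ × ℝ) := contDiff_snd.prodMk contDiff_fst
    obtain ⟨C, hC, h⟩ := exists_integral_norm_sq_iterate_le
      (hf.comp (hsw.of_le (by exact_mod_cast le_top))) (hφ.comp hsw)
      (hs.comp_homeomorph (Homeomorph.prodComm ℝ ℝ)) hg (add_comm r.1 r.2 ▸ hr)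
    refine ⟨C + 1, by positivity, fun j _ _ ℓ hℓ => ?_⟩
    obtain ⟨s, h0, h1, e₁, e₂, e₃, e₄⟩ := hscale j
    rw [e₂] at hℓ ⊢
    rw [e₄]
    have ha : |(ℓ : ℝ) * s| ≤ 1 := by
      rw [abs_mul, abs_of_pos h0]
      exact (mul_le_mul_of_nonneg_right hℓ h0.le).trans_eq (inv_mul_cancel₀ h0.ne')
    set Q : ℝ × ℝ → ℂ := fun z => FT (fun x => ((f x * φ (s⁻¹ * x.1, s⁻¹ * x.2) : ℝ) : ℂ)) z *
      (PsiJL g false j ℓ z : ℂ) with hQ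
    have hb := (h s (ℓ * s) (fun z => Q z.swap) h0 h1 ha fun z => ?_).2
    · rw [pd1_iterate_comp_swap, pd2_iterate_comp_swap] at hb
      have mp : MeasurePreserving (Prod.swap : ℝ × ℝ → ℝ × ℝ) := Measure.measurePreserving_swap
      rw [mp.integral_comp MeasurableEquiv.prodComm.measurableEmbedding
        (fun ξ => ‖pd1^[r.1] (pd2^[r.2] Q) ξ‖ ^ 2), add_comm r.2] at hb
      exact hb.trans (by gcongr; linarith)
    · simp only [hQ, PsiJL, PsiV, e₁, e₃, ← FT_comp_swap, Bool.false_eq_true, if_false]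
      simp only [Function.comp_apply, Prod.fst_swap, Prod.snd_swap, Prod.swap_prod_mk]
      rw [mul_comm (g _)]
      congr 4 <;> ring_nf
end
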